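/- arXiv:1102.0715 — 2 statements merged into one kernel-verified Lean document; each statement's English description precedes it below -/
import Mathlib

section
/- Let r be an odd positive integer and define U_r = 4 if 3 divides r and U_r = 12 if 3 does not divide r. Then the ideal of the ring of integers generated by the set of integers {U_r * a^2 : a ∈ ℤ} together with {U_r * (r^2 - 6*a*r + 6*a^2) / 12 : a ∈ ℤ} (each of which is an integer) is the whole ring; equivalently, the greatest common divisor of all these integers equals 1. -/
theorem stmt_5 (r : ℤ) (hr : 0 < r) (hodd : Odd r) (U : ℤ)
    (hU : U = if (3 : ℤ) ∣ r then 4 else 12) :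
    Ideal.span ({x : ℤ | ∃ a : ℤ, x = U * a ^ 2} ∪
      {x : ℤ | ∃ a : ℤ, 12 * x = U * (r ^ 2 - 6 * a * r + 6 * a ^ 2)}) = ⊤ := by
  -- The generator `U` (from `a = 1`) is coprime to `U * r ^ 2 / 12` (from `a = 0`).
  suffices h : ∃ y, 12 * y = U * r ^ 2 ∧ IsCoprime U y by
    obtain ⟨y, hy, u, v, huv⟩ := h
    rw [Ideal.eq_top_iff_one, ← huv]
    refine Ideal.add_mem _ (Ideal.mul_mem_left _ u (Ideal.subset_span (Or.inl ⟨1, by ring⟩)))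
      (Ideal.mul_mem_left _ v (Ideal.subset_span (Or.inr ⟨0, ?_⟩)))
    rw [hy]
    ring
  split_ifs at hU with h3
  · obtain ⟨m, rfl⟩ := h3
    obtain ⟨n, rfl⟩ := (Int.odd_mul.mp hodd).2
    refine ⟨3 * (2 * n + 1) ^ 2, by rw [hU]; ring, 1 + 3 * (n ^ 2 + n), -1, by rw [hU]; ring⟩
  · refine ⟨r ^ 2, by rw [hU], ?_⟩
    have hr2 : IsCoprime 2 r := Int.isCoprime_two_left.mpr hodd
    have hr3 : IsCoprime 3 r := (Int.prime_three.coprime_iff_not_dvd).mpr h3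
    rw [hU, show (12 : ℤ) = 2 ^ 2 * 3 by norm_num]
    exact (hr2.pow_left.mul_left hr3).pow_right
end

section
/- Let r be an even positive integer and define U_r = 2 if 12 divides r; U_r = 4 if 3 divides r and 4 does not divide r; U_r = 6 if 4 divides r and 3 does not divide r; U_r = 12 if neither 4 nor 3 divides r. Then the ideal of the ring of integers generated by the set of integers {U_r * a^2 : a ∈ ℤ} together with {U_r * (r^2 - 6*a*r + 6*a^2) / 12 : a ∈ ℤ} and the integer U_r * r^2 / 48 is the whole ring; equivalently, the greatest common divisor of all these integers equals 1. -/
theorem Ideal.span_eq_top_of_isCoprime_mem {R : Type*} [CommSemiring R] {S : Set R} {x y : R}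
    (hx : x ∈ S) (hy : y ∈ S) (h : IsCoprime x y) : Ideal.span S = ⊤ := by
  obtain ⟨a, b, hab⟩ := h
  rw [Ideal.eq_top_iff_one, ← hab]
  exact Ideal.add_mem _ (Ideal.mul_mem_left _ _ (Ideal.subset_span hx))
    (Ideal.mul_mem_left _ _ (Ideal.subset_span hy))

theorem stmt_6 (r : ℤ) (hr : 0 < r) (hre : Even r) (U : ℤ)
    (hU : U = if (12 : ℤ) ∣ r then 2
          else if (3 : ℤ) ∣ r ∧ ¬ (4 : ℤ) ∣ r then 4
          else if (4 : ℤ) ∣ r ∧ ¬ (3 : ℤ) ∣ r then 6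
          else 12) :
    Ideal.span ({x : ℤ | ∃ a : ℤ, x = U * a ^ 2} ∪
      {x : ℤ | ∃ a : ℤ, 12 * x = U * (r ^ 2 - 6 * a * r + 6 * a ^ 2)} ∪
      {x : ℤ | 48 * x = U * r ^ 2}) = ⊤ := by
  have hκ : U ∈ {x : ℤ | ∃ a : ℤ, x = U * a ^ 2} := ⟨1, by ring⟩
  have of_lam (y : ℤ) (hy : 12 * y = U * (r ^ 2 - 6 * 1 * r + 6 * 1 ^ 2)) (h : IsCoprime U y) :=
    Ideal.span_eq_top_of_isCoprime_mem (S := {x : ℤ | ∃ a : ℤ, x = U * a ^ 2} ∪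
      {x : ℤ | ∃ a : ℤ, 12 * x = U * (r ^ 2 - 6 * a * r + 6 * a ^ 2)} ∪
      {x : ℤ | 48 * x = U * r ^ 2}) (.inl (.inl hκ)) (.inl (.inr ⟨1, hy⟩)) h
  have of_mu (y : ℤ) (hy : 48 * y = U * r ^ 2) (h : IsCoprime U y) :=
    Ideal.span_eq_top_of_isCoprime_mem (S := {x : ℤ | ∃ a : ℤ, x = U * a ^ 2} ∪
      {x : ℤ | ∃ a : ℤ, 12 * x = U * (r ^ 2 - 6 * a * r + 6 * a ^ 2)} ∪
      {x : ℤ | 48 * x = U * r ^ 2}) (.inl (.inl hκ)) (.inr hy) h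
  rw [Int.even_iff] at hre
  split_ifs at hU with h12 h3 h4
  · obtain ⟨k, rfl⟩ := h12
    exact of_lam (24 * k ^ 2 - 12 * k + 1) (by rw [hU]; ring)
      ⟨-(12 * k ^ 2 - 6 * k), 1, by rw [hU]; ring⟩
  · obtain ⟨n, rfl⟩ : ∃ n, r = 6 * (2 * n + 1) := ⟨r / 12, by omega⟩
    exact of_mu (3 * (2 * n + 1) ^ 2) (by rw [hU]; ring)
      ⟨3 * n ^ 2 + 3 * n + 1, -1, by rw [hU]; ring⟩
  · obtain ⟨n, rfl | rfl⟩ : ∃ n, r = 4 * (3 * n + 1) ∨ r = 4 * (3 * n - 1) :=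
      ⟨(r + 4) / 12, by omega⟩
    · exact of_lam (8 * (3 * n + 1) ^ 2 - 12 * (3 * n + 1) + 3) (by rw [hU]; ring)
        ⟨12 * n ^ 2 + 2 * n, -1, by rw [hU]; ring⟩
    · exact of_lam (8 * (3 * n - 1) ^ 2 - 12 * (3 * n - 1) + 3) (by rw [hU]; ring)
        ⟨12 * n ^ 2 - 14 * n + 4, -1, by rw [hU]; ring⟩
  · obtain ⟨n, rfl | rfl⟩ : ∃ n, r = 2 * (6 * n + 1) ∨ r = 2 * (6 * n - 1) :=
      ⟨(r + 2) / 12, by omega⟩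
    · exact of_mu ((6 * n + 1) ^ 2) (by rw [hU]; ring)
        ⟨-(3 * n ^ 2 + n), 1, by rw [hU]; ring⟩
    · exact of_mu ((6 * n - 1) ^ 2) (by rw [hU]; ring)
        ⟨-(3 * n ^ 2 - n), 1, by rw [hU]; ring⟩
end
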